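/- (Shapirovskii) Let X be an almost regular topological space. Then the number ρ(X) of regular open subsets of X satisfies ρ(X) ≤ πχ(X)^{c(X)}, where πχ(X) is the π-character and c(X) the cellularity of X. -/

import Mathlib

open Cardinal Set

universe u v

/-- The collection 𝒪_X of all open covers of `X`. -/
def openCovers (X : Type u) [TopologicalSpace X] : Set (Set (Set X)) :=
  {𝒰 | (∀ U ∈ 𝒰, IsOpen U) ∧ ⋃₀ 𝒰 = Set.univ}

/-- The collection 𝒪̄_X of all families of open sets whose closures cover `X`. -/
def closureCovers (X : Type u) [TopologicalSpace X] : Set (Set (Set X)) :=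
  {𝒰 | (∀ U ∈ 𝒰, IsOpen U) ∧ (⋃ U ∈ 𝒰, closure U) = Set.univ}

/-- The collection 𝒟_X of all families of open sets with dense union. -/
def denseFamilies (X : Type u) [TopologicalSpace X] : Set (Set (Set X)) :=
  {𝒰 | (∀ U ∈ 𝒰, IsOpen U) ∧ Dense (⋃₀ 𝒰)}

/-- A cellular family: a family of pairwise disjoint non-empty open sets. -/
def IsCellularFamily (X : Type u) [TopologicalSpace X] (𝒞 : Set (Set X)) : Prop :=
  (∀ U ∈ 𝒞, IsOpen U ∧ U.Nonempty) ∧ 𝒞.PairwiseDisjoint id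

/-- The collection 𝒞_X of all maximal cellular families of `X`. -/
def maximalCellularFamilies (X : Type u) [TopologicalSpace X] : Set (Set (Set X)) :=
  {𝒞 | IsCellularFamily X 𝒞 ∧ ∀ 𝒞' : Set (Set X), IsCellularFamily X 𝒞' → 𝒞 ⊆ 𝒞' → 𝒞' = 𝒞}

/-- Player two has a winning strategy in the game `G^ι_1(A, B)` on the space `X`, where
innings are indexed by the linearly ordered type `ι`: at inning `β` player one plays
`p β ∈ A` and player two, seeing player one's moves up to and including inning `β`, picks an
element of `p β`; player two wins a play if the set of all his choices belongs to `B`. -/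
def P2WinsG1 (X : Type u) [TopologicalSpace X] (ι : Type v) [LinearOrder ι]
    (A B : Set (Set (Set X))) : Prop :=
  ∃ σ : (β : ι) → ({γ : ι // γ ≤ β} → Set (Set X)) → Set X,
    ∀ p : ι → Set (Set X), (∀ β, p β ∈ A) →
      (∀ β, σ β (fun γ => p γ.1) ∈ p β) ∧
      Set.range (fun β => σ β (fun γ => p γ.1)) ∈ B

/-- Player two has a winning strategy in the game `G^ι_fin(A, B)` on the space `X`:
at inning `β` player one plays `p β ∈ A` and player two picks a finite subset of `p β`;
player two wins a play if the union of all his choices belongs to `B`. -/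
def P2WinsGfin (X : Type u) [TopologicalSpace X] (ι : Type v) [LinearOrder ι]
    (A B : Set (Set (Set X))) : Prop :=
  ∃ σ : (β : ι) → ({γ : ι // γ ≤ β} → Set (Set X)) → Set (Set X),
    ∀ p : ι → Set (Set X), (∀ β, p β ∈ A) →
      (∀ β, σ β (fun γ => p γ.1) ⊆ p β ∧ (σ β (fun γ => p γ.1)).Finite) ∧
      {V | ∃ β, V ∈ σ β (fun γ => p γ.1)} ∈ B

/-- `X` has countable closed pseudocharacter: every point has a countable family of open
neighbourhoods the intersection of whose closures is exactly that point. -/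
def CountableClosedPseudocharacter (X : Type u) [TopologicalSpace X] : Prop :=
  ∀ x : X, ∃ 𝒱 : Set (Set X), 𝒱.Countable ∧ (∀ V ∈ 𝒱, IsOpen V ∧ x ∈ V) ∧
    (⋂ V ∈ 𝒱, closure V) = {x}

/-- `X` is almost regular: every non-empty open set contains the closure of a
non-empty open set. -/
def AlmostRegular (X : Type u) [TopologicalSpace X] : Prop :=
  ∀ U : Set X, IsOpen U → U.Nonempty → ∃ V : Set X, IsOpen V ∧ V.Nonempty ∧ closure V ⊆ U

/-- `Y` is relatively H-closed in `X`: every open cover of `X` has a finite subfamily whose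
closures cover `Y`. -/
def RelativelyHClosed (X : Type u) [TopologicalSpace X] (Y : Set X) : Prop :=
  ∀ 𝒰 ∈ openCovers X, ∃ 𝒱 : Set (Set X), 𝒱 ⊆ 𝒰 ∧ 𝒱.Finite ∧ Y ⊆ ⋃ U ∈ 𝒱, closure U

/-- A local π-base at `x`: a family of non-empty open sets such that every open
neighbourhood of `x` contains a member of the family. -/
def IsLocalPiBase (X : Type u) [TopologicalSpace X] (x : X) (B : Set (Set X)) : Prop :=
  (∀ V ∈ B, IsOpen V ∧ V.Nonempty) ∧ ∀ U : Set X, IsOpen U → x ∈ U → ∃ V ∈ B, V ⊆ U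

/-- A π-base of `X`: a family of non-empty open sets such that every non-empty open set
contains a member of the family. -/
def IsPiBase (X : Type u) [TopologicalSpace X] (B : Set (Set X)) : Prop :=
  (∀ V ∈ B, IsOpen V ∧ V.Nonempty) ∧ ∀ U : Set X, IsOpen U → U.Nonempty → ∃ V ∈ B, V ⊆ U

/-- The π-character πχ(X): the least infinite cardinal `κ` such that every point of `X`
has a local π-base of cardinality at most `κ`. -/
noncomputable def piCharacter (X : Type u) [TopologicalSpace X] : Cardinal.{u} :=
  sInf {κ | Cardinal.aleph0 ≤ κ ∧
    ∀ x : X, ∃ B : Set (Set X), Cardinal.mk ↥B ≤ κ ∧ IsLocalPiBase X x B}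

/-- The π-weight πw(X): the least infinite cardinality of a π-base of `X`. -/
noncomputable def piWeight (X : Type u) [TopologicalSpace X] : Cardinal.{u} :=
  sInf {κ | Cardinal.aleph0 ≤ κ ∧ ∃ B : Set (Set X), IsPiBase X B ∧ Cardinal.mk ↥B ≤ κ}

/-- The cellularity c(X): the supremum, together with ℵ₀, of the cardinalities of cellular
families in `X`. -/
noncomputable def cellularity (X : Type u) [TopologicalSpace X] : Cardinal.{u} :=
  max Cardinal.aleph0
    (sSup {κ | ∃ 𝒞 : Set (Set X), IsCellularFamily X 𝒞 ∧ Cardinal.mk ↥𝒞 = κ})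

lemma IsCellularFamily.mk_le_cellularity {X : Type u} [TopologicalSpace X] {𝒞 : Set (Set X)}
    (h : IsCellularFamily X 𝒞) : #𝒞 ≤ cellularity X := by
  refine le_max_of_le_right (le_csSup ?_ ⟨𝒞, h, rfl⟩)
  refine ⟨#(Set X), ?_⟩
  rintro _ ⟨𝒟, -, rfl⟩
  exact Cardinal.mk_set_le 𝒟

/-- The infimum defining the π-character is attained. -/
lemma piCharacter_spec (X : Type u) [TopologicalSpace X] :
    ℵ₀ ≤ piCharacter X ∧
      ∀ x : X, ∃ B : Set (Set X), #B ≤ piCharacter X ∧ IsLocalPiBase X x B := by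
  refine csInf_mem (s := {κ : Cardinal.{u} | ℵ₀ ≤ κ ∧
    ∀ x : X, ∃ B : Set (Set X), #B ≤ κ ∧ IsLocalPiBase X x B})
    ⟨max ℵ₀ #(Set X), le_max_left _ _, fun x => ⟨{V | IsOpen V ∧ V.Nonempty},
      (Cardinal.mk_set_le _).trans (le_max_right _ _), fun V hV => hV, fun U hU hx =>
      ⟨U, ⟨hU, x, hx⟩, Subset.rfl⟩⟩⟩

/-- The local π-bases can be indexed by a single type of cardinality the π-character. -/
lemma exists_indexed_localPiBase (X : Type u) [TopologicalSpace X] :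
    ∃ B : X → (piCharacter X).out → Set X,
      (∀ x p, IsOpen (B x p) ∧ (B x p).Nonempty) ∧
        ∀ (x : X) (U : Set X), IsOpen U → x ∈ U → ∃ p, B x p ⊆ U := by
  have key : ∀ x : X, ∃ b : (piCharacter X).out → Set X,
      (∀ p, IsOpen (b p) ∧ (b p).Nonempty) ∧
        ∀ U : Set X, IsOpen U → x ∈ U → ∃ p, b p ⊆ U := by
    intro x
    obtain ⟨B, hcard, hopen, hB⟩ := (piCharacter_spec X).2 x
    obtain ⟨V₀, hV₀, -⟩ := hB univ isOpen_univ (mem_univ x)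
    have : Nonempty B := ⟨⟨V₀, hV₀⟩⟩
    rw [← Cardinal.mk_out (piCharacter X)] at hcard
    obtain ⟨e⟩ := hcard
    have hsurj := Function.invFun_surjective e.injective
    refine ⟨fun p => (Function.invFun e p : B).1, fun p => hopen _ (Function.invFun e p).2, ?_⟩
    intro U hU hx
    obtain ⟨V, hV, hVU⟩ := hB U hU hx
    obtain ⟨p, hp⟩ := hsurj ⟨V, hV⟩
    exact ⟨p, by simpa [hp] using hVU⟩
  choose B h₁ h₂ using key
  exact ⟨B, h₁, h₂⟩

/-- Every non-empty family of open sets has a subfamily of size at most the cellularity with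
the same closure of the union. -/
lemma exists_subfamily_subset_closure {X : Type u} [TopologicalSpace X] {ι : Type v}
    (G : ι → Set X) (S : Set ι) (hS : S.Nonempty) (hG : ∀ i ∈ S, IsOpen (G i)) :
    ∃ f : (cellularity X).out → ι, (∀ k, f k ∈ S) ∧
      ∀ i ∈ S, G i ⊆ closure (⋃ k, G (f k)) := by
  obtain ⟨𝒞, h𝒞⟩ := zorn_subset
    {𝒞 : Set (Set X) | IsCellularFamily X 𝒞 ∧ ∀ C ∈ 𝒞, ∃ i ∈ S, C ⊆ G i} (by
      intro c hc hchain
      refine ⟨⋃₀ c, ⟨⟨?_, ?_⟩, ?_⟩, fun s hs => subset_sUnion_of_mem hs⟩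
      · rintro U ⟨s, hs, hU⟩
        exact (hc hs).1.1 U hU
      · exact (pairwiseDisjoint_sUnion hchain.directedOn).2 fun s hs => (hc hs).1.2
      · rintro U ⟨s, hs, hU⟩
        exact (hc hs).2 U hU)
  obtain ⟨hcell, hsub⟩ := h𝒞.prop
  have hcard := hcell.mk_le_cellularity
  rw [← Cardinal.mk_out (cellularity X)] at hcard
  obtain ⟨e⟩ := hcard
  choose g hgS hg using hsub
  obtain ⟨s₀, hs₀⟩ := hS
  let F : (cellularity X).out → S :=
    Function.extend e (fun C => ⟨g C.1 C.2, hgS C.1 C.2⟩) fun _ => ⟨s₀, hs₀⟩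
  refine ⟨fun k => (F k).1, fun k => (F k).2, ?_⟩
  intro i hi x hx
  by_contra hcl
  have hC : ∀ C ∈ 𝒞, C ⊆ ⋃ k, G (F k).1 := fun C hC => by
    refine (hg C hC).trans fun y hy => mem_iUnion.2 ⟨e ⟨C, hC⟩, ?_⟩
    simpa [F, e.injective.extend_apply] using hy
  set O : Set X := G i ∩ (closure (⋃ k, G (F k).1))ᶜ with hO
  have hOdisj : ∀ C ∈ 𝒞, Disjoint O C := fun C hC' =>
    Set.disjoint_left.2 fun y hy hyC => hy.2 (subset_closure (hC C hC' hyC))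
  have hOx : x ∈ O := ⟨hx, hcl⟩
  have hmem : insert O 𝒞 ∈
      {𝒞 : Set (Set X) | IsCellularFamily X 𝒞 ∧ ∀ C ∈ 𝒞, ∃ i ∈ S, C ⊆ G i} := by
    refine ⟨⟨?_, ?_⟩, ?_⟩
    · rintro U (rfl | hU)
      · exact ⟨(hG i hi).inter isClosed_closure.isOpen_compl, x, hOx⟩
      · exact hcell.1 U hU
    · exact hcell.2.insert fun C hC' _ => hOdisj C hC'
    · rintro U (rfl | hU)
      · exact ⟨i, hi, inter_subset_left⟩
      · exact ⟨g U hU, hgS U hU, hg U hU⟩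
  have hO𝒞 : O ∈ 𝒞 := h𝒞.le_of_ge hmem (subset_insert _ _) (mem_insert _ _)
  exact Set.disjoint_left.1 (hOdisj O hO𝒞) hOx hOx

lemma piCharacter_power_cellularity_power (X : Type u) [TopologicalSpace X] :
    (piCharacter X ^ cellularity X) ^ cellularity X = piCharacter X ^ cellularity X := by
  rw [← Cardinal.power_mul, Cardinal.mul_eq_self (c := cellularity X) (le_max_left _ _)]

lemma aleph0_le_piCharacter_power_cellularity (X : Type u) [TopologicalSpace X] :
    ℵ₀ ≤ piCharacter X ^ cellularity X :=
  (piCharacter_spec X).1.trans <| Cardinal.self_le_power _ <|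
    Cardinal.one_le_aleph0.trans (le_max_left _ _)

/-- An almost regular space has a dense subset of size at most `πχ(X) ^ c(X)`, given here as a
family indexed by a type of that size. -/
lemma AlmostRegular.exists_denseRange {X : Type u} [TopologicalSpace X] [Nonempty X]
    (hreg : AlmostRegular X) :
    ∃ (A : Type u) (a : A → X), #A ≤ piCharacter X ^ cellularity X ∧ DenseRange a := by
  obtain ⟨B, hBopen, hB⟩ := exists_indexed_localPiBase X
  let K := (cellularity X).out
  let P := (piCharacter X).out
  let arity : Option (K → P) → Type u := fun o => o.elim PEmpty fun _ => K
  let next : Set X → X := fun s => Classical.epsilon fun x => x ∉ s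
  -- Points obtained by repeatedly avoiding closures of unions of small families of π-base members.
  let step : (Σ o, arity o → X) → X := fun t =>
    match t with
    | ⟨none, _⟩ => Classical.arbitrary X
    | ⟨some p, f⟩ => next (closure (⋃ k, B (f k) (p k)))
  let a : WType arity → X := WType.elim X step
  refine ⟨WType arity, a, ?_, ?_⟩
  · have hinf := aleph0_le_piCharacter_power_cellularity X
    have harity : ∀ o, (piCharacter X ^ cellularity X) ^ #(arity o) ≤
        piCharacter X ^ cellularity X := by
      rintro (_ | p)
      · simpa [arity] using Cardinal.one_le_aleph0.trans hinf
      · simpa [arity, K] using (piCharacter_power_cellularity_power X).le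
    refine WType.cardinalMk_le_of_le ((Cardinal.sum_le_sum _ _ harity).trans ?_)
    rw [Cardinal.sum_const', Cardinal.mk_option, ← Cardinal.power_def, Cardinal.mk_out,
      Cardinal.mk_out, Cardinal.add_one_eq hinf, Cardinal.mul_eq_self hinf]
  · by_contra hd
    have hne : ((closure (range a))ᶜ).Nonempty := by
      rw [nonempty_compl]
      exact fun h => hd (dense_iff_closure_eq.2 h)
    obtain ⟨V, hVo, ⟨v, hv⟩, hV⟩ := hreg _ isClosed_closure.isOpen_compl hne
    have haV : ∀ w, a w ∈ (closure V)ᶜ := fun w hw => hV hw (subset_closure ⟨w, rfl⟩)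
    let S : Set (WType arity × P) := {i | B (a i.1) i.2 ⊆ (closure V)ᶜ}
    have hlocal : ∀ w U, IsOpen U → a w ∈ U → ∃ p, (w, p) ∈ S ∧ B (a w) p ⊆ U := by
      intro w U hU hw
      obtain ⟨p, hp⟩ := hB (a w) (U ∩ (closure V)ᶜ) (hU.inter isClosed_closure.isOpen_compl)
        ⟨hw, haV w⟩
      exact ⟨p, hp.trans inter_subset_right, hp.trans inter_subset_left⟩
    let w₀ : WType arity := ⟨none, PEmpty.elim⟩
    obtain ⟨p₀, hp₀, -⟩ := hlocal w₀ univ isOpen_univ (mem_univ _)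
    obtain ⟨f, hfS, hf⟩ := exists_subfamily_subset_closure
      (fun i : WType arity × P => B (a i.1) i.2) S ⟨_, hp₀⟩ fun i _ => (hBopen _ _).1
    let w : WType arity := ⟨some fun k => (f k).2, fun k => (f k).1⟩
    have haw : a w ∉ closure (⋃ k, B (a (f k).1) (f k).2) := by
      refine Classical.epsilon_spec (p := fun x => x ∉ closure (⋃ k, B (a (f k).1) (f k).2))
        ⟨v, fun hvcl => ?_⟩
      obtain ⟨y, hyV, hy⟩ := mem_closure_iff.1 hvcl V hVo hv
      obtain ⟨k, hk⟩ := mem_iUnion.1 hy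
      exact hfS k hk (subset_closure hyV)
    obtain ⟨p, hpS, hp⟩ := hlocal w _ isClosed_closure.isOpen_compl haw
    obtain ⟨y, hy⟩ := (hBopen (a w) p).2
    exact hp hy (hf _ hpS hy)

theorem stmt_16 {X : Type u} [TopologicalSpace X] (hreg : AlmostRegular X) :
    Cardinal.mk {U : Set X // U = interior (closure U)} ≤
      piCharacter X ^ cellularity X := by
  have hinf := aleph0_le_piCharacter_power_cellularity X
  rcases isEmpty_or_nonempty X with hX | hX
  · exact (Cardinal.le_one_iff_subsingleton.2 inferInstance).trans
      (Cardinal.one_le_aleph0.trans hinf)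
  obtain ⟨A, a, hA, ha⟩ := hreg.exists_denseRange
  obtain ⟨B, hBopen, hB⟩ := exists_indexed_localPiBase X
  let K := (cellularity X).out
  let P := (piCharacter X).out
  let r : (K → A × P) → Set X := fun f => interior (closure (⋃ k, B (a (f k).1) (f k).2))
  have hsub : {U : Set X | U = interior (closure U)} ⊆ insert ∅ (range r) := by
    intro U hU
    rcases U.eq_empty_or_nonempty with rfl | hne
    · exact mem_insert _ _
    refine mem_insert_of_mem _ ?_
    have hUo : IsOpen U := by
      rw [show U = interior (closure U) from hU]
      exact isOpen_interior
    let S : Set (A × P) := {i | B (a i.1) i.2 ⊆ U}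
    have hpi : ∀ O ⊆ U, IsOpen O → O.Nonempty → ∃ i ∈ S, B (a i.1) i.2 ⊆ O := by
      intro O hOU hO hOne
      obtain ⟨z, hz⟩ := ha.exists_mem_open hO hOne
      obtain ⟨p, hp⟩ := hB _ O hO hz
      exact ⟨(z, p), hp.trans hOU, hp⟩
    obtain ⟨i₀, hi₀, -⟩ := hpi U Subset.rfl hUo hne
    obtain ⟨f, hfS, hf⟩ := exists_subfamily_subset_closure
      (fun i : A × P => B (a i.1) i.2) S ⟨i₀, hi₀⟩ fun i _ => (hBopen _ _).1
    refine ⟨f, ?_⟩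
    have hcl : closure (⋃ k, B (a (f k).1) (f k).2) = closure U := by
      refine (closure_mono (iUnion_subset hfS)).antisymm
        (closure_minimal (fun x hx => ?_) isClosed_closure)
      by_contra hxcl
      obtain ⟨i, hi, hiO⟩ := hpi (U ∩ (closure (⋃ k, B (a (f k).1) (f k).2))ᶜ)
        inter_subset_left (hUo.inter isClosed_closure.isOpen_compl) ⟨x, hx, hxcl⟩
      obtain ⟨y, hy⟩ := (hBopen (a i.1) i.2).2
      exact (hiO hy).2 (hf i hi hy)
    change interior (closure (⋃ k, B (a (f k).1) (f k).2)) = U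
    rw [hcl]
    exact hU.symm
  have hP : piCharacter X ≤ piCharacter X ^ cellularity X :=
    Cardinal.self_le_power _ (Cardinal.one_le_aleph0.trans (le_max_left _ _))
  calc #{U : Set X // U = interior (closure U)}
      ≤ #(insert ∅ (range r) : Set (Set X)) := Cardinal.mk_le_mk_of_subset hsub
    _ ≤ #(range r) + 1 := Cardinal.mk_insert_le
    _ ≤ #(K → A × P) + 1 := by gcongr; exact Cardinal.mk_range_le
    _ = (#A * piCharacter X) ^ cellularity X + 1 := by simp [K, P]
    _ ≤ ((piCharacter X ^ cellularity X) * (piCharacter X ^ cellularity X)) ^ cellularity X + 1 := by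
        gcongr
        exact Cardinal.power_le_power_right (mul_le_mul' hA hP)
    _ = piCharacter X ^ cellularity X := by
        rw [Cardinal.mul_eq_self hinf, piCharacter_power_cellularity_power,
          Cardinal.add_one_eq hinf]
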